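/- Let N_{A→B} be a quantum channel. For every separable bipartite state ρ_{E_AE_B} (i.e., a state in the convex hull of product states across the cut E_A:E_B), entanglement assistance gives no advantage: χ_ρ(N) = I_ρ(N) = χ(N). -/

import Mathlib

open scoped Kronecker ComplexOrder
open Matrix

noncomputable section

namespace QIT

/-- Base-2 logarithm of a Hermitian matrix, via the spectral theorem
(junk value `0` on non-Hermitian inputs). -/
def matLog {ι : Type*} [Fintype ι] [DecidableEq ι] (ρ : Matrix ι ι ℂ) : Matrix ι ι ℂ :=
  if h : ρ.IsHermitian then
    (h.eigenvectorUnitary : Matrix ι ι ℂ) *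
      Matrix.diagonal (fun i => (Real.logb 2 (h.eigenvalues i) : ℂ)) *
      star (h.eigenvectorUnitary : Matrix ι ι ℂ)
  else 0

/-- Von Neumann entropy (base 2): `S(ρ) = -tr[ρ log ρ]`. -/
def entropy {ι : Type*} [Fintype ι] [DecidableEq ι] (ρ : Matrix ι ι ℂ) : ℝ :=
  -(ρ * matLog ρ).trace.re

/-- Quantum relative entropy (base 2): `D(ρ‖σ) = tr[ρ (log ρ - log σ)]`. -/
def relEnt {ι : Type*} [Fintype ι] [DecidableEq ι] (ρ σ : Matrix ι ι ℂ) : ℝ :=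
  (ρ * (matLog ρ - matLog σ)).trace.re

/-- A quantum state: positive semidefinite with unit trace. -/
def IsState {ι : Type*} [Fintype ι] (ρ : Matrix ι ι ℂ) : Prop :=
  ρ.PosSemidef ∧ ρ.trace = 1

/-- A pure state: a rank-one outer product `|v⟩⟨v|`. -/
def IsPure {ι : Type*} [Fintype ι] (ρ : Matrix ι ι ℂ) : Prop :=
  ∃ v : ι → ℂ, ρ = Matrix.vecMulVec v (star v)

/-- Partial trace over the second (right) tensor factor. -/
def ptrR {α β : Type*} [Fintype β] (ρ : Matrix (α × β) (α × β) ℂ) : Matrix α α ℂ :=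
  Matrix.of fun a a' => ∑ b, ρ (a, b) (a', b)

/-- Partial trace over the first (left) tensor factor. -/
def ptrL {α β : Type*} [Fintype α] (ρ : Matrix (α × β) (α × β) ℂ) : Matrix β β ℂ :=
  Matrix.of fun b b' => ∑ a, ρ (a, b) (a, b')

/-- Quantum mutual information `I(A:B) = S(ρ_A) + S(ρ_B) - S(ρ_{AB})` (entropy form). -/
def mutualInfoS {α β : Type*} [Fintype α] [DecidableEq α] [Fintype β] [DecidableEq β]
    (ρ : Matrix (α × β) (α × β) ℂ) : ℝ :=
  entropy (ptrR ρ) + entropy (ptrL ρ) - entropy ρ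

/-- Quantum mutual information `I(A:B) = D(ρ_{AB} ‖ ρ_A ⊗ ρ_B)` (relative-entropy form). -/
def mutualInfoD {α β : Type*} [Fintype α] [DecidableEq α] [Fintype β] [DecidableEq β]
    (ρ : Matrix (α × β) (α × β) ℂ) : ℝ :=
  relEnt ρ (ptrR ρ ⊗ₖ ptrL ρ)

/-- Tensoring a linear map on matrices with the identity on the left: `id_γ ⊗ L`. -/
def lTensor {α β : Type*} (γ : Type*) (L : Matrix α α ℂ →ₗ[ℂ] Matrix β β ℂ) :
    Matrix (γ × α) (γ × α) ℂ →ₗ[ℂ] Matrix (γ × β) (γ × β) ℂ where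
  toFun ρ := Matrix.of fun p q => L (Matrix.of fun a a' => ρ (p.1, a) (q.1, a')) p.2 q.2
  map_add' ρ σ := by
    ext p q
    have h : (Matrix.of fun a a' => ρ (p.1, a) (q.1, a') + σ (p.1, a) (q.1, a')) =
        (Matrix.of fun a a' => ρ (p.1, a) (q.1, a')) +
          Matrix.of fun a a' => σ (p.1, a) (q.1, a') := rfl
    simp only [Matrix.of_apply, Matrix.add_apply, h, map_add]
  map_smul' c ρ := by
    ext p q
    have h : (Matrix.of fun a a' => c * ρ (p.1, a) (q.1, a')) =
        c • Matrix.of fun a a' => ρ (p.1, a) (q.1, a') := rfl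
    simp only [Matrix.of_apply, Matrix.smul_apply, smul_eq_mul, RingHom.id_apply, h,
      _root_.map_smul]

/-- Tensoring a linear map on matrices with the identity on the right: `L ⊗ id_γ`. -/
def rTensor {α β : Type*} (γ : Type*) (L : Matrix α α ℂ →ₗ[ℂ] Matrix β β ℂ) :
    Matrix (α × γ) (α × γ) ℂ →ₗ[ℂ] Matrix (β × γ) (β × γ) ℂ where
  toFun ρ := Matrix.of fun p q => L (Matrix.of fun a a' => ρ (a, p.2) (a', q.2)) p.1 q.1
  map_add' ρ σ := by
    ext p q
    have h : (Matrix.of fun a a' => ρ (a, p.2) (a', q.2) + σ (a, p.2) (a', q.2)) =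
        (Matrix.of fun a a' => ρ (a, p.2) (a', q.2)) +
          Matrix.of fun a a' => σ (a, p.2) (a', q.2) := rfl
    simp only [Matrix.of_apply, Matrix.add_apply, h, map_add]
  map_smul' c ρ := by
    ext p q
    have h : (Matrix.of fun a a' => c * ρ (a, p.2) (a', q.2)) =
        c • Matrix.of fun a a' => ρ (a, p.2) (a', q.2) := rfl
    simp only [Matrix.of_apply, Matrix.smul_apply, smul_eq_mul, RingHom.id_apply, h,
      _root_.map_smul]

/-- A quantum channel: a completely positive trace-preserving linear map. -/
structure QChannel (α β : Type*) [Fintype α] [DecidableEq α] [Fintype β] [DecidableEq β] where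
  map : Matrix α α ℂ →ₗ[ℂ] Matrix β β ℂ
  cp : ∀ (n : ℕ) (ρ : Matrix (Fin n × α) (Fin n × α) ℂ), ρ.PosSemidef →
    ((lTensor (Fin n) map) ρ).PosSemidef
  tp : ∀ ρ : Matrix α α ℂ, (map ρ).trace = ρ.trace

/-- The classical-quantum state `Σ_x p(x) |x⟩⟨x| ⊗ σ^x`. -/
def cqState {ι γ : Type*} [DecidableEq ι] (p : ι → ℝ) (σ : ι → Matrix γ γ ℂ) :
    Matrix (ι × γ) (ι × γ) ℂ :=
  Matrix.of fun a b => if a.1 = b.1 then (p a.1 : ℂ) * σ a.1 a.2 b.2 else 0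

/-- A probability distribution on a finite alphabet. -/
def IsProbDist {ι : Type*} [Fintype ι] (p : ι → ℝ) : Prop :=
  (∀ x, 0 ≤ p x) ∧ ∑ x, p x = 1

section Assisted

variable {EA EB A B : Type*} [Fintype EA] [DecidableEq EA] [Fintype EB] [DecidableEq EB]
  [Fintype A] [DecidableEq A] [Fintype B] [DecidableEq B]

/-- The output state `(N ∘ E ⊗ id_{E_B})(ρ_{E_AE_B})` on `B ⊗ E_B`. -/
def assistedOut (N : QChannel A B) (E : QChannel EA A)
    (ρ : Matrix (EA × EB) (EA × EB) ℂ) : Matrix (B × EB) (B × EB) ℂ :=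
  rTensor EB (N.map ∘ₗ E.map) ρ

/-- The classical-quantum state
`ω_{XBE_B} = Σ_x p(x) |x⟩⟨x|_X ⊗ (N∘E^x ⊗ id_{E_B})(ρ_{E_AE_B})`. -/
def assistedCQ (N : QChannel A B) (ρ : Matrix (EA × EB) (EA × EB) ℂ)
    {n : ℕ} (p : Fin n → ℝ) (E : Fin n → QChannel EA A) :
    Matrix (Fin n × (B × EB)) (Fin n × (B × EB)) ℂ :=
  cqState p fun x => assistedOut N (E x) ρ

/-- Marginal of a state on `X ⊗ (B ⊗ E_B)` obtained by tracing out `B`. -/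
def margXE {X : Type*} (ω : Matrix (X × (B × EB)) (X × (B × EB)) ℂ) :
    Matrix (X × EB) (X × EB) ℂ :=
  Matrix.of fun p q => ∑ b, ω (p.1, (b, p.2)) (q.1, (b, q.2))

/-- `I(XE_B:B)` of a state on `X ⊗ (B ⊗ E_B)` (entropy form). -/
def infoXE_B {X : Type*} [Fintype X] [DecidableEq X]
    (ω : Matrix (X × (B × EB)) (X × (B × EB)) ℂ) : ℝ :=
  entropy (margXE ω) + entropy (ptrR (ptrL ω)) - entropy ω

/-- Regrouping `(X × E_B) × B ≃ X × (B × E_B)`. -/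
def regroupEquiv (X B EB : Type*) : (X × EB) × B ≃ X × (B × EB) :=
  (Equiv.prodAssoc X EB B).trans (Equiv.prodCongr (Equiv.refl X) (Equiv.prodComm EB B))

/-- `I(XE_B:B)` of a state on `X ⊗ (B ⊗ E_B)` (relative-entropy form). -/
def infoXE_B_D {X : Type*} [Fintype X] [DecidableEq X]
    (ω : Matrix (X × (B × EB)) (X × (B × EB)) ℂ) : ℝ :=
  mutualInfoD (ω.submatrix (regroupEquiv X B EB) (regroupEquiv X B EB))

/-- The `ρ`-assisted Holevo information `χ_ρ(N)` (entropy form of `I`). -/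
def assistedHolevoS (N : QChannel A B) (ρ : Matrix (EA × EB) (EA × EB) ℂ) : ℝ :=
  sSup { r | ∃ (n : ℕ) (p : Fin n → ℝ) (E : Fin n → QChannel EA A),
    IsProbDist p ∧ r = mutualInfoS (assistedCQ N ρ p E) }

/-- The `ρ`-assisted Holevo information `χ_ρ(N)` (relative-entropy form of `I`). -/
def assistedHolevoD (N : QChannel A B) (ρ : Matrix (EA × EB) (EA × EB) ℂ) : ℝ :=
  sSup { r | ∃ (n : ℕ) (p : Fin n → ℝ) (E : Fin n → QChannel EA A),
    IsProbDist p ∧ r = mutualInfoD (assistedCQ N ρ p E) }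

/-- The `ρ`-assisted mutual information `I_ρ(N)` (entropy form of `I`). -/
def assistedMutualS (N : QChannel A B) (ρ : Matrix (EA × EB) (EA × EB) ℂ) : ℝ :=
  sSup { r | ∃ (n : ℕ) (p : Fin n → ℝ) (E : Fin n → QChannel EA A),
    IsProbDist p ∧ r = infoXE_B (assistedCQ N ρ p E) }

/-- The `ρ`-assisted mutual information `I_ρ(N)` (relative-entropy form of `I`). -/
def assistedMutualD (N : QChannel A B) (ρ : Matrix (EA × EB) (EA × EB) ℂ) : ℝ :=
  sSup { r | ∃ (n : ℕ) (p : Fin n → ℝ) (E : Fin n → QChannel EA A),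
    IsProbDist p ∧ r = infoXE_B_D (assistedCQ N ρ p E) }

/-- The (unassisted) Holevo information `χ(N)` (entropy form of `I`). -/
def holevoS (N : QChannel A B) : ℝ :=
  sSup { r | ∃ (n : ℕ) (p : Fin n → ℝ) (σ : Fin n → Matrix A A ℂ),
    IsProbDist p ∧ (∀ x, IsState (σ x)) ∧
    r = mutualInfoS (cqState p fun x => N.map (σ x)) }

/-- The (unassisted) Holevo information `χ(N)` (relative-entropy form of `I`). -/
def holevoD (N : QChannel A B) : ℝ :=
  sSup { r | ∃ (n : ℕ) (p : Fin n → ℝ) (σ : Fin n → Matrix A A ℂ),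
    IsProbDist p ∧ (∀ x, IsState (σ x)) ∧
    r = mutualInfoD (cqState p fun x => N.map (σ x)) }

end Assisted

section ChannelMI

variable {A B : Type*} [Fintype A] [DecidableEq A] [Fintype B] [DecidableEq B]

/-- `φ_{AA'}` is a purification of `ρ_A`: a pure state whose marginal on the
first factor is `ρ_A`. -/
def IsPurification {A' : Type*} [Fintype A']
    (φ : Matrix (A × A') (A × A') ℂ) (ρ : Matrix A A ℂ) : Prop :=
  IsState φ ∧ IsPure φ ∧ ptrR φ = ρ

/-- The mutual information of the channel `N`,
`I(N) = max_{ρ_A} I(A':B)_{(N ⊗ id)(φ_{AA'})}` (purifying system `A' ≅ A`). -/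
def channelMI (N : QChannel A B) : ℝ :=
  sSup { r | ∃ (ρA : Matrix A A ℂ) (φ : Matrix (A × A) (A × A) ℂ),
    IsState ρA ∧ IsPurification φ ρA ∧ r = mutualInfoS (rTensor A N.map φ) }

end ChannelMI

section Coding

variable {EA EB A B : Type*} [Fintype EA] [DecidableEq EA] [Fintype EB] [DecidableEq EB]
  [Fintype A] [DecidableEq A] [Fintype B] [DecidableEq B]

/-- Product of `n` states on `B ⊗ E_B`, arranged on `B^n ⊗ E_B^n`. -/
def prodState {n : ℕ} (τ : Fin n → Matrix (B × EB) (B × EB) ℂ) :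
    Matrix ((Fin n → B) × (Fin n → EB)) ((Fin n → B) × (Fin n → EB)) ℂ :=
  Matrix.of fun p q => ∏ i, τ i (p.1 i, p.2 i) (q.1 i, q.2 i)

/-- Product of `n` states on `B ⊗ E_B`, with the `B^n` systems permuted by `π`. -/
def permProdState {n : ℕ} (π : Equiv.Perm (Fin n))
    (τ : Fin n → Matrix (B × EB) (B × EB) ℂ) :
    Matrix ((Fin n → B) × (Fin n → EB)) ((Fin n → B) × (Fin n → EB)) ℂ :=
  Matrix.of fun p q => ∏ i, τ i (p.1 (π i), p.2 i) (q.1 (π i), q.2 i)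

/-- Average decoding error probability of a code with message-dependent output
states `ω^m` and decoding POVM `{Λ_m}`. -/
def avgErr {n M : ℕ}
    (ω : Fin M → Matrix ((Fin n → B) × (Fin n → EB)) ((Fin n → B) × (Fin n → EB)) ℂ)
    (Λ : Fin M → Matrix ((Fin n → B) × (Fin n → EB)) ((Fin n → B) × (Fin n → EB)) ℂ) : ℝ :=
  (1 / (M : ℝ)) * ∑ m, ((1 - Λ m) * ω m).trace.re

/-- Existence of a blocklength-`n`, `M`-message, error-`≤ ε` code with product
encodings for the state-channel pair `(ρ, N)`. -/
def ProdCode (N : QChannel A B) (ρ : Matrix (EA × EB) (EA × EB) ℂ)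
    (n M : ℕ) (ε : ℝ) : Prop :=
  ∃ (Enc : Fin M → Fin n → QChannel EA A)
    (Λ : Fin M → Matrix ((Fin n → B) × (Fin n → EB)) ((Fin n → B) × (Fin n → EB)) ℂ),
    (∀ m, (Λ m).PosSemidef) ∧ (∑ m, Λ m) = 1 ∧
    avgErr (fun m => prodState fun i => assistedOut N (Enc m i) ρ) Λ ≤ ε

/-- Existence of a blocklength-`n`, `M`-message, error-`≤ ε` code with
semi-global encodings (local encodings followed by a global permutation). -/
def SemiGlobalCode (N : QChannel A B) (ρ : Matrix (EA × EB) (EA × EB) ℂ)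
    (n M : ℕ) (ε : ℝ) : Prop :=
  ∃ (Enc : Fin M → Fin n → QChannel EA A) (perm : Fin M → Equiv.Perm (Fin n))
    (Λ : Fin M → Matrix ((Fin n → B) × (Fin n → EB)) ((Fin n → B) × (Fin n → EB)) ℂ),
    (∀ m, (Λ m).PosSemidef) ∧ (∑ m, Λ m) = 1 ∧
    avgErr (fun m => permProdState (perm m) fun i => assistedOut N (Enc m i) ρ) Λ ≤ ε

/-- `R` is an `ε`-achievable rate with product encodings. -/
def ProdAchievable (N : QChannel A B) (ρ : Matrix (EA × EB) (EA × EB) ℂ)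
    (ε R : ℝ) : Prop :=
  ∀ δ : ℝ, 0 < δ → ∃ n₀ : ℕ, ∀ n ≥ n₀, ∃ M : ℕ,
    R - δ ≤ Real.logb 2 M / n ∧ ProdCode N ρ n M ε

/-- `R` is an `ε`-achievable rate with semi-global encodings. -/
def SemiGlobalAchievable (N : QChannel A B) (ρ : Matrix (EA × EB) (EA × EB) ℂ)
    (ε R : ℝ) : Prop :=
  ∀ δ : ℝ, 0 < δ → ∃ n₀ : ℕ, ∀ n ≥ n₀, ∃ M : ℕ,
    R - δ ≤ Real.logb 2 M / n ∧ SemiGlobalCode N ρ n M ε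

/-- The `ρ`-assisted `ε`-classical capacity with product encodings. -/
def prodCapacity (N : QChannel A B) (ρ : Matrix (EA × EB) (EA × EB) ℂ) (ε : ℝ) : ℝ :=
  sSup { R | ProdAchievable N ρ ε R }

/-- The `ρ`-assisted `ε`-classical capacity with semi-global encodings. -/
def semiGlobalCapacity (N : QChannel A B) (ρ : Matrix (EA × EB) (EA × EB) ℂ) (ε : ℝ) : ℝ :=
  sSup { R | SemiGlobalAchievable N ρ ε R }

end Coding

/-- The phase (Weyl) unitary `Z^u = Σ_z e^{2πiuz/d}|z⟩⟨z|` on `ℂ^d`. -/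
def Zmat (d : ℕ) (u : Fin d) : Matrix (Fin d) (Fin d) ℂ :=
  Matrix.diagonal fun z => Complex.exp (2 * Real.pi * Complex.I * u.1 * z.1 / d)

/-- Conjugation of a bipartite state by the phase unitary `Z^u ⊗ 1`. -/
def phaseConj {EB : Type*} [Fintype EB] [DecidableEq EB] (d : ℕ) (u : Fin d)
    (φ : Matrix (Fin d × EB) (Fin d × EB) ℂ) : Matrix (Fin d × EB) (Fin d × EB) ℂ :=
  (Zmat d u ⊗ₖ (1 : Matrix EB EB ℂ)) * φ * (Zmat d u ⊗ₖ (1 : Matrix EB EB ℂ))ᴴ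

/-- The (unnormalized) conditional operator `⟨z|φ|z⟩` on `E_B`. -/
def condState {EB : Type*} {d : ℕ} (φ : Matrix (Fin d × EB) (Fin d × EB) ℂ)
    (z : Fin d) : Matrix EB EB ℂ :=
  Matrix.of fun e e' => φ (z, e) (z, e')

/-- Shannon entropy (base 2) of a probability vector. -/
def shannonEnt {ι : Type*} [Fintype ι] (p : ι → ℝ) : ℝ :=
  -∑ i, p i * Real.logb 2 (p i)

/-- Binary entropy (base 2). -/
def binEnt (p : ℝ) : ℝ :=
  -(p * Real.logb 2 p) - (1 - p) * Real.logb 2 (1 - p)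

/-- Kullback-Leibler divergence (base 2) between probability vectors. -/
def klDiv {ι : Type*} [Fintype ι] (p q : ι → ℝ) : ℝ :=
  ∑ i, p i * Real.logb 2 (p i / q i)

section Discord

variable {α β : Type*} [Fintype α] [DecidableEq α] [Fintype β] [DecidableEq β]

/-- The (unnormalized) operator `⟨v|ρ|v⟩` on `α`, sandwiching on the second factor. -/
def sandwichR (ρ : Matrix (α × β) (α × β) ℂ) (v : β → ℂ) : Matrix α α ℂ :=
  Matrix.of fun a a' => ∑ b, ∑ b', star (v b) * ρ (a, b) (a', b') * v b'

/-- The relative entropy of discord `D_R(ρ_{AB})`. -/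
def relEntDiscord (ρ : Matrix (α × β) (α × β) ℂ) : ℝ :=
  sInf { r | ∃ V ∈ Matrix.unitaryGroup β ℂ, r = relEnt ρ
    (∑ y : β, sandwichR ρ (fun b => V b y) ⊗ₖ
      Matrix.vecMulVec (fun b => V b y) (star fun b => V b y)) }

/-- The discord of formation `D_F(ρ_{AB})`. -/
def discordOfFormation (ρ : Matrix (α × β) (α × β) ℂ) : ℝ :=
  sInf { r | ∃ (n : ℕ) (p : Fin n → ℝ) (τ : Fin n → Matrix (α × β) (α × β) ℂ),
    IsProbDist p ∧ (∀ x, IsState (τ x)) ∧ (ρ = ∑ x, (p x : ℂ) • τ x) ∧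
    r = ∑ x, p x * relEntDiscord (τ x) }

end Discord

section Diagonalization

variable {ι κ : Type*} [Fintype ι] [DecidableEq ι] [Fintype κ] [DecidableEq κ]

/-- The columns of the unitary `U` form an eigenbasis of `ρ` with real eigenvalues `r`. -/
structure Diagonalizes (U : Matrix ι ι ℂ) (r : ι → ℝ) (ρ : Matrix ι ι ℂ) : Prop where
  unitary : Uᴴ * U = 1
  eq : ρ = U * diagonal (fun i => (r i : ℂ)) * Uᴴ

namespace Diagonalizes

variable {U : Matrix ι ι ℂ} {r : ι → ℝ} {ρ : Matrix ι ι ℂ}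
  {V : Matrix κ κ ℂ} {s : κ → ℝ} {τ : Matrix κ κ ℂ}

lemma unitary' (h : Diagonalizes U r ρ) : U * Uᴴ = 1 :=
  mul_eq_one_comm.mp h.unitary

lemma isHermitian (h : Diagonalizes U r ρ) : ρ.IsHermitian := by
  rw [h.eq]
  refine isHermitian_mul_mul_conjTranspose U ?_
  simp [IsHermitian, diagonal_conjTranspose, Pi.star_def]

lemma charpoly_eq (h : Diagonalizes U r ρ) :
    ρ.charpoly = ∏ i, (Polynomial.X - Polynomial.C (r i : ℂ)) := by
  rw [h.eq, Matrix.charpoly_mul_comm, ← Matrix.mul_assoc, h.unitary, Matrix.one_mul,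
    charpoly_diagonal]

lemma trace_eq (h : Diagonalizes U r ρ) : ρ.trace = ∑ i, (r i : ℂ) := by
  rw [h.eq, trace_mul_comm, ← Matrix.mul_assoc, h.unitary, Matrix.one_mul, trace_diagonal]

lemma conj_eq (h : Diagonalizes U r ρ) : Uᴴ * ρ * U = diagonal (fun i => (r i : ℂ)) := by
  rw [h.eq]
  simp only [← Matrix.mul_assoc, h.unitary, Matrix.one_mul]
  rw [Matrix.mul_assoc, h.unitary, Matrix.mul_one]

lemma sum_eigenvalues (h : Diagonalizes U r ρ) (f : ℝ → ℝ) :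
    ∑ i, f (h.isHermitian.eigenvalues i) = ∑ i, f (r i) := by
  have h1 := h.isHermitian.roots_charpoly_eq_eigenvalues
  rw [h.charpoly_eq, Polynomial.roots_prod _ _
    (Finset.prod_ne_zero_iff.mpr fun i _ => Polynomial.X_sub_C_ne_zero _)] at h1
  simp only [Polynomial.roots_X_sub_C, Multiset.bind_singleton] at h1
  have h2 := congrArg (fun m => (m.map fun z : ℂ => f z.re).sum) h1
  simpa [Multiset.map_map, Function.comp_def] using h2.symm

lemma kronecker (h : Diagonalizes U r ρ) (h' : Diagonalizes V s τ) :
    Diagonalizes (U ⊗ₖ V) (fun i => r i.1 * s i.2) (ρ ⊗ₖ τ) where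
  unitary := by
    rw [conjTranspose_kronecker, ← mul_kronecker_mul, h.unitary, h'.unitary, one_kronecker_one]
  eq := by
    rw [conjTranspose_kronecker, h.eq, h'.eq]
    simp only [Complex.ofReal_mul]
    rw [← diagonal_kronecker_diagonal (fun i => (r i : ℂ)) (fun i => (s i : ℂ)),
      ← mul_kronecker_mul, ← mul_kronecker_mul]

lemma smul (h : Diagonalizes U r ρ) (c : ℝ) :
    Diagonalizes U (fun i => c * r i) ((c : ℂ) • ρ) where
  unitary := h.unitary
  eq := by
    have : diagonal (fun i => ((c * r i : ℝ) : ℂ)) = (c : ℂ) • diagonal (fun i => (r i : ℂ)) := by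
      ext i j
      simp [diagonal_apply]
    rw [this, h.eq, Matrix.mul_smul, Matrix.smul_mul]

lemma one (hU : Uᴴ * U = 1) : Diagonalizes U (fun _ => 1) 1 where
  unitary := hU
  eq := by simp [mul_eq_one_comm.mp hU]

end Diagonalizes

lemma _root_.Matrix.IsHermitian.diagonalizes {ρ : Matrix ι ι ℂ} (h : ρ.IsHermitian) :
    Diagonalizes (h.eigenvectorUnitary : Matrix ι ι ℂ) h.eigenvalues ρ where
  unitary := Unitary.coe_star_mul_self h.eigenvectorUnitary
  eq := by
    conv_lhs => rw [h.spectral_theorem]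
    rw [Unitary.conjStarAlgAut_apply]
    rfl

lemma Diagonalizes.entropy_eq {U : Matrix ι ι ℂ} {r : ι → ℝ} {ρ : Matrix ι ι ℂ}
    (h : Diagonalizes U r ρ) : entropy ρ = (∑ i, Real.negMulLog (r i)) / Real.log 2 := by
  have hh := h.isHermitian
  rw [← h.sum_eigenvalues, entropy, matLog, dif_pos hh]
  have hd := hh.diagonalizes
  have hE : ρ * ((hh.eigenvectorUnitary : Matrix ι ι ℂ) *
      diagonal (fun i => (Real.logb 2 (hh.eigenvalues i) : ℂ)) *
      star (hh.eigenvectorUnitary : Matrix ι ι ℂ)) =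
      (hh.eigenvectorUnitary : Matrix ι ι ℂ) *
      diagonal (fun i => ((hh.eigenvalues i * Real.logb 2 (hh.eigenvalues i) : ℝ) : ℂ)) *
      (hh.eigenvectorUnitary : Matrix ι ι ℂ)ᴴ := by
    have hu := hd.unitary
    have hρ := hd.eq
    generalize (hh.eigenvectorUnitary : Matrix ι ι ℂ) = W at hu hρ ⊢
    generalize hh.eigenvalues = e at hρ ⊢
    rw [hρ]
    simp only [Complex.ofReal_mul]
    rw [← diagonal_mul_diagonal, star_eq_conjTranspose]
    simp only [Matrix.mul_assoc]
    rw [← Matrix.mul_assoc Wᴴ W, hu, Matrix.one_mul]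
  rw [hE, trace_mul_comm, ← Matrix.mul_assoc, hd.unitary, Matrix.one_mul, trace_diagonal,
    ← Complex.ofReal_sum, Complex.ofReal_re, Finset.sum_div, ← Finset.sum_neg_distrib]
  refine Finset.sum_congr rfl fun i _ => ?_
  simp only [Real.negMulLog, Real.logb]
  ring

end Diagonalization

section Entropy

variable {ι κ γ : Type*} [Fintype ι] [DecidableEq ι] [Fintype κ] [DecidableEq κ]
  [Fintype γ] [DecidableEq γ]

lemma entropy_diagonal (p : ι → ℝ) :
    entropy (diagonal fun i => (p i : ℂ)) = (∑ i, Real.negMulLog (p i)) / Real.log 2 :=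
  Diagonalizes.entropy_eq (U := 1) ⟨by simp, by simp⟩

omit [Fintype ι] [Fintype γ] [DecidableEq γ] in
lemma cqState_eq_submatrix (p : ι → ℝ) (σ : ι → Matrix γ γ ℂ) :
    cqState p σ = (blockDiagonal fun x => (p x : ℂ) • σ x).submatrix
      (Equiv.prodComm ι γ) (Equiv.prodComm ι γ) := by
  ext a b
  simp only [cqState, of_apply, submatrix_apply, blockDiagonal_apply, Equiv.prodComm_apply,
    Prod.fst_swap, Prod.snd_swap, Matrix.smul_apply, smul_eq_mul]

lemma Diagonalizes.cqState {U : ι → Matrix γ γ ℂ} {r : ι → γ → ℝ} {σ : ι → Matrix γ γ ℂ}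
    (h : ∀ x, Diagonalizes (U x) (r x) (σ x)) (p : ι → ℝ) :
    Diagonalizes ((blockDiagonal U).submatrix (Equiv.prodComm ι γ) (Equiv.prodComm ι γ))
      (fun a => p a.1 * r a.1 a.2) (QIT.cqState p σ) where
  unitary := by
    rw [conjTranspose_submatrix, submatrix_mul_equiv, blockDiagonal_conjTranspose,
      ← blockDiagonal_mul]
    simp only [(h _).unitary]
    rw [← Pi.one_def, blockDiagonal_one, submatrix_one_equiv]
  eq := by
    have hd : diagonal (fun a : ι × γ => ((p a.1 * r a.1 a.2 : ℝ) : ℂ)) =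
        (blockDiagonal fun x => diagonal fun i => ((p x * r x i : ℝ) : ℂ)).submatrix
          (Equiv.prodComm ι γ) (Equiv.prodComm ι γ) := by
      rw [blockDiagonal_diagonal, submatrix_diagonal_equiv]
      rfl
    rw [cqState_eq_submatrix, hd, conjTranspose_submatrix, submatrix_mul_equiv,
      submatrix_mul_equiv, blockDiagonal_conjTranspose, ← blockDiagonal_mul, ← blockDiagonal_mul]
    congr 2
    funext x
    exact ((h x).smul (p x)).eq

lemma entropy_cqState {p : ι → ℝ} {σ : ι → Matrix γ γ ℂ} (hσ : ∀ x, (σ x).IsHermitian)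
    (htr : ∀ x, (σ x).trace = 1) :
    entropy (cqState p σ) =
      (∑ x, Real.negMulLog (p x)) / Real.log 2 + ∑ x, p x * entropy (σ x) := by
  rw [(Diagonalizes.cqState (fun x => (hσ x).diagonalizes) p).entropy_eq]
  simp only [fun x => (hσ x).diagonalizes.entropy_eq]
  rw [Fintype.sum_prod_type]
  simp only [Real.negMulLog_mul, Finset.sum_add_distrib, ← Finset.sum_mul, ← Finset.mul_sum]
  have h1 : ∀ x, ∑ i, (hσ x).eigenvalues i = 1 := fun x => by
    have := (hσ x).diagonalizes.trace_eq
    rw [htr x] at this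
    exact_mod_cast this.symm
  simp only [h1, one_mul, add_div, Finset.sum_div, mul_div_assoc]

omit [Fintype ι] [DecidableEq γ] in
lemma ptrR_cqState {p : ι → ℝ} {σ : ι → Matrix γ γ ℂ} (htr : ∀ x, (σ x).trace = 1) :
    ptrR (cqState p σ) = diagonal fun x => (p x : ℂ) := by
  ext x y
  by_cases hxy : x = y
  · subst hxy
    have := htr x
    simp only [trace, diag_apply] at this
    simp [ptrR, cqState, ← Finset.mul_sum, this]
  · simp [ptrR, cqState, hxy]

omit [Fintype γ] [DecidableEq γ] in
lemma ptrL_cqState (p : ι → ℝ) (σ : ι → Matrix γ γ ℂ) :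
    ptrL (cqState p σ) = ∑ x, (p x : ℂ) • σ x := by
  ext a b
  simp [ptrL, cqState, Matrix.sum_apply]

lemma mutualInfoS_cqState {p : ι → ℝ} {σ : ι → Matrix γ γ ℂ} (hσ : ∀ x, (σ x).IsHermitian)
    (htr : ∀ x, (σ x).trace = 1) :
    mutualInfoS (cqState p σ) =
      entropy (∑ x, (p x : ℂ) • σ x) - ∑ x, p x * entropy (σ x) := by
  rw [mutualInfoS, ptrR_cqState htr, ptrL_cqState, entropy_cqState hσ htr, entropy_diagonal]
  ring

end Entropy

section RelativeEntropy

/-- The nonnegative integrand `r log r - r log s - r + s` of the relative entropy. -/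
def relTerm (r s : ℝ) : ℝ := -Real.negMulLog r - r * Real.log s - r + s

/-- Integral representation of `relTerm` by resolvents. -/
lemma relTerm_integral {r s : ℝ} (hr : 0 ≤ r) (hs : 0 ≤ s) (h0 : s = 0 → r = 0) :
    IntervalIntegrable (fun u => (1 - u) * ((r - s) ^ 2 / (u * r + (1 - u) * s)))
      MeasureTheory.volume 0 1 ∧
    ∫ u in (0 : ℝ)..1, (1 - u) * ((r - s) ^ 2 / (u * r + (1 - u) * s)) = relTerm r s := by
  rcases hs.eq_or_lt with rfl | hs
  · obtain rfl := h0 rfl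
    simp [relTerm]
  have hpos : ∀ u ∈ Set.Ioo (0 : ℝ) 1, 0 < u * r + (1 - u) * s := fun u hu =>
    add_pos_of_nonneg_of_pos (mul_nonneg hu.1.le hr) (mul_pos (sub_pos.2 hu.2) hs)
  let Φ : ℝ → ℝ := fun u => r * Real.log (u * r + (1 - u) * s) - (r - s) * u
  have hcont : ContinuousOn Φ (Set.Icc 0 1) := by
    rcases hr.eq_or_lt with rfl | hr
    · simp only [Φ, zero_mul, zero_sub]
      fun_prop
    · refine ContinuousOn.sub (ContinuousOn.mul continuousOn_const
        (ContinuousOn.log (by fun_prop) fun u hu => ?_)) (by fun_prop)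
      rcases hu.1.eq_or_lt with rfl | hu0
      · simpa using hs.ne'
      · exact (add_pos_of_pos_of_nonneg (mul_pos hu0 hr)
          (mul_nonneg (sub_nonneg.2 hu.2) hs.le)).ne'
  have hderiv : ∀ u ∈ Set.Ioo (0 : ℝ) 1, HasDerivAt Φ
      ((1 - u) * ((r - s) ^ 2 / (u * r + (1 - u) * s))) u := fun u hu => by
    have hlin : HasDerivAt (fun u : ℝ => u * r + (1 - u) * s) (1 * r + (0 - 1) * s) u :=
      ((hasDerivAt_id u).mul_const r).add
        (((hasDerivAt_const u (1 : ℝ)).sub (hasDerivAt_id u)).mul_const s)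
    have h := ((hlin.log (hpos u hu).ne').const_mul r).sub ((hasDerivAt_id u).const_mul (r - s))
    have hne := (hpos u hu).ne'
    have he : (1 - u) * ((r - s) ^ 2 / (u * r + (1 - u) * s)) =
        r * ((1 * r + (0 - 1) * s) / (u * r + (1 - u) * s)) - (r - s) * 1 := by
      field_simp
      ring
    rw [he]
    exact h
  have hInt : IntervalIntegrable (fun u => (1 - u) * ((r - s) ^ 2 / (u * r + (1 - u) * s)))
      MeasureTheory.volume 0 1 := by
    refine intervalIntegral.intervalIntegrable_deriv_of_nonneg (g := Φ) ?_ ?_ ?_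
    · rwa [Set.uIcc_of_le zero_le_one]
    · simpa using hderiv
    · simp only [min_eq_left zero_le_one, max_eq_right zero_le_one]
      exact fun u hu => mul_nonneg (sub_nonneg.2 hu.2.le) (div_nonneg (sq_nonneg _) (hpos u hu).le)
  refine ⟨hInt, ?_⟩
  rw [intervalIntegral.integral_eq_sub_of_hasDerivAt_of_le zero_le_one hcont hderiv hInt]
  simp [Φ, relTerm, Real.negMulLog]
  ring

lemma relTerm_nonneg {r s : ℝ} (hr : 0 ≤ r) (hs : 0 ≤ s) (h0 : s = 0 → r = 0) :
    0 ≤ relTerm r s := by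
  rw [← (relTerm_integral hr hs h0).2]
  exact intervalIntegral.integral_nonneg zero_le_one fun u hu =>
    mul_nonneg (sub_nonneg.2 hu.2) (div_nonneg (sq_nonneg _)
      (add_nonneg (mul_nonneg hu.1 hr) (mul_nonneg (sub_nonneg.2 hu.2) hs)))

variable {ι κ : Type*} [Fintype ι] [DecidableEq ι]

/-- The relative entropy `D(ρ‖σ) - tr ρ + tr σ` (natural logarithm) computed from eigenbases
`U`, `V` and eigenvalues `r`, `s` of `ρ` and `σ`. -/
def spectralRel (U : Matrix ι ι ℂ) (r : ι → ℝ) (V : Matrix ι ι ℂ) (s : ι → ℝ) : ℝ :=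
  ∑ i, ∑ j, Complex.normSq ((Uᴴ * V) i j) * relTerm (r i) (s j)

/-- The support condition `supp ρ ⊆ supp σ` in terms of eigenbases. -/
def SupportLE (U : Matrix ι ι ℂ) (r : ι → ℝ) (V : Matrix ι ι ℂ) (s : ι → ℝ) : Prop :=
  ∀ i j, (Uᴴ * V) i j ≠ 0 → s j = 0 → r i = 0

/-- The integrand of `spectralRel` in its integral representation. -/
def resolventForm (U : Matrix ι ι ℂ) (r : ι → ℝ) (V : Matrix ι ι ℂ) (s : ι → ℝ) (u : ℝ) : ℝ :=
  ∑ i, ∑ j, Complex.normSq ((Uᴴ * V) i j) * ((r i - s j) ^ 2 / (u * r i + (1 - u) * s j))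

/-- The concave quadratic functional of `Z` whose maximum is `resolventForm`. -/
def quadForm (u : ℝ) (Z ρ σ : Matrix ι ι ℂ) : ℝ :=
  2 * ((Zᴴ * ρ).trace.re - (Zᴴ * σ).trace.re) - u * (Zᴴ * ρ * Z).trace.re
    - (1 - u) * (Z * σ * Zᴴ).trace.re

omit [DecidableEq ι] in
lemma quadForm_sum [Fintype κ] (u : ℝ) (Z : Matrix ι ι ℂ) (ρ σ : κ → Matrix ι ι ℂ) :
    quadForm u Z (∑ k, ρ k) (∑ k, σ k) = ∑ k, quadForm u Z (ρ k) (σ k) := by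
  simp only [quadForm, Matrix.sum_mul, trace_sum, Complex.re_sum,
    Finset.sum_sub_distrib, Finset.mul_sum, mul_sub]

omit [DecidableEq ι] in
lemma trace_conjTranspose_mul_re (X Y : Matrix ι ι ℂ) :
    (Xᴴ * Y).trace.re = ∑ i, ∑ j, (star (X i j) * Y i j).re := by
  rw [Finset.sum_comm]
  simp [trace, Matrix.mul_apply]

lemma quadForm_eq {U V ρ σ : Matrix ι ι ℂ} {r s : ι → ℝ} (hρ : Diagonalizes U r ρ)
    (hσ : Diagonalizes V s σ) (u : ℝ) (Y : Matrix ι ι ℂ) :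
    quadForm u (U * Y * Vᴴ) ρ σ = ∑ i, ∑ j,
      (2 * (r i - s j) * (star (Y i j) * (Uᴴ * V) i j).re
        - (u * r i + (1 - u) * s j) * Complex.normSq (Y i j)) := by
  have e1 : ((U * Y * Vᴴ)ᴴ * ρ).trace = (Yᴴ * (diagonal (fun i => (r i : ℂ)) * (Uᴴ * V))).trace := by
    rw [hρ.eq, conjTranspose_mul, conjTranspose_conjTranspose, conjTranspose_mul]
    simp only [Matrix.mul_assoc]
    rw [← Matrix.mul_assoc Uᴴ U, hρ.unitary, Matrix.one_mul, trace_mul_comm]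
    simp only [Matrix.mul_assoc]
  have e2 : ((U * Y * Vᴴ)ᴴ * σ).trace = (Yᴴ * (Uᴴ * V * diagonal (fun i => (s i : ℂ)))).trace := by
    rw [hσ.eq, conjTranspose_mul, conjTranspose_conjTranspose, conjTranspose_mul]
    simp only [Matrix.mul_assoc]
    rw [trace_mul_comm]
    simp only [Matrix.mul_assoc]
    rw [hσ.unitary, Matrix.mul_one]
  have e3 : ((U * Y * Vᴴ)ᴴ * ρ * (U * Y * Vᴴ)).trace
      = (Yᴴ * (diagonal (fun i => (r i : ℂ)) * Y)).trace := by
    rw [hρ.eq, conjTranspose_mul, conjTranspose_conjTranspose, conjTranspose_mul]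
    simp only [Matrix.mul_assoc]
    rw [← Matrix.mul_assoc Uᴴ U, hρ.unitary, Matrix.one_mul, ← Matrix.mul_assoc Uᴴ U,
      hρ.unitary, Matrix.one_mul, trace_mul_comm]
    simp only [Matrix.mul_assoc]
    rw [hσ.unitary, Matrix.mul_one]
  have e4 : ((U * Y * Vᴴ) * σ * (U * Y * Vᴴ)ᴴ).trace
      = (Yᴴ * (Y * diagonal (fun i => (s i : ℂ)))).trace := by
    rw [hσ.eq, conjTranspose_mul, conjTranspose_conjTranspose, conjTranspose_mul]
    simp only [Matrix.mul_assoc]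
    rw [← Matrix.mul_assoc Vᴴ V, hσ.unitary, Matrix.one_mul, ← Matrix.mul_assoc Vᴴ V,
      hσ.unitary, Matrix.one_mul, trace_mul_comm]
    simp only [Matrix.mul_assoc]
    rw [hρ.unitary, Matrix.mul_one, trace_mul_comm Yᴴ]
    simp only [Matrix.mul_assoc]
  rw [quadForm, e1, e2, e3, e4]
  simp only [trace_conjTranspose_mul_re, ← Finset.sum_sub_distrib, Finset.mul_sum]
  refine Finset.sum_congr rfl fun i _ => Finset.sum_congr rfl fun j _ => ?_
  simp only [diagonal_mul, mul_diagonal, Complex.star_def, Complex.mul_re, Complex.mul_im,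
    Complex.conj_re, Complex.conj_im, Complex.ofReal_re, Complex.ofReal_im, Complex.normSq_apply]
  ring

lemma quadForm_le_resolventForm {U V ρ σ : Matrix ι ι ℂ} {r s : ι → ℝ}
    (hρ : Diagonalizes U r ρ) (hσ : Diagonalizes V s σ) (hr : ∀ i, 0 ≤ r i) (hs : ∀ i, 0 ≤ s i)
    {u : ℝ} (hu : u ∈ Set.Ioo (0 : ℝ) 1) (Z : Matrix ι ι ℂ) :
    quadForm u Z ρ σ ≤ resolventForm U r V s u := by
  have hZ : Z = U * (Uᴴ * Z * V) * Vᴴ := by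
    simp only [← Matrix.mul_assoc]
    rw [hρ.unitary', Matrix.one_mul, Matrix.mul_assoc, hσ.unitary', Matrix.mul_one]
  rw [hZ, quadForm_eq hρ hσ, resolventForm]
  refine Finset.sum_le_sum fun i _ => Finset.sum_le_sum fun j _ => ?_
  generalize (Uᴴ * Z * V) i j = y
  generalize (Uᴴ * V) i j = w
  have hri := mul_nonneg hu.1.le (hr i)
  have hsj := mul_nonneg (sub_nonneg.2 hu.2.le) (hs j)
  rcases (add_nonneg hri hsj).eq_or_lt with hd | hd
  · have h1 : r i = 0 := by
      have : u * r i = 0 := by linarith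
      exact (mul_eq_zero.1 this).resolve_left hu.1.ne'
    have h2 : s j = 0 := by
      have : (1 - u) * s j = 0 := by linarith
      exact (mul_eq_zero.1 this).resolve_left (sub_pos.2 hu.2).ne'
    simp [h1, h2]
  · generalize u * r i + (1 - u) * s j = d at hd
    generalize r i - s j = t
    have key : 0 ≤ ((t * w.re - d * y.re) ^ 2 + (t * w.im - d * y.im) ^ 2) / d := by positivity
    have : Complex.normSq w * (t ^ 2 / d) -
        (2 * t * (star y * w).re - d * Complex.normSq y) =
        ((t * w.re - d * y.re) ^ 2 + (t * w.im - d * y.im) ^ 2) / d := by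
      simp only [Complex.star_def, Complex.mul_re, Complex.conj_re, Complex.conj_im,
        Complex.normSq_apply]
      field_simp
      ring
    linarith

lemma exists_quadForm_eq_resolventForm {U V ρ σ : Matrix ι ι ℂ} {r s : ι → ℝ}
    (hρ : Diagonalizes U r ρ) (hσ : Diagonalizes V s σ) (u : ℝ) :
    ∃ Z, quadForm u Z ρ σ = resolventForm U r V s u := by
  refine ⟨U * (of fun i j => (((r i - s j) / (u * r i + (1 - u) * s j) : ℝ) : ℂ) *
    (Uᴴ * V) i j) * Vᴴ, ?_⟩
  rw [quadForm_eq hρ hσ, resolventForm]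
  refine Finset.sum_congr rfl fun i _ => Finset.sum_congr rfl fun j _ => ?_
  rw [of_apply]
  generalize (Uᴴ * V) i j = w
  generalize u * r i + (1 - u) * s j = d
  generalize r i - s j = t
  simp only [Complex.star_def, map_mul, Complex.conj_ofReal, mul_assoc, Complex.re_ofReal_mul,
    Complex.normSq_ofReal, ← Complex.normSq_eq_conj_mul_self, Complex.ofReal_re]
  by_cases hd : d = 0
  · simp [hd]
  · field_simp
    ring

omit [DecidableEq ι] in
lemma spectralRel_integral {U V : Matrix ι ι ℂ} {r s : ι → ℝ} (hr : ∀ i, 0 ≤ r i)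
    (hs : ∀ i, 0 ≤ s i) (hsupp : SupportLE U r V s) :
    IntervalIntegrable (fun u => (1 - u) * resolventForm U r V s u) MeasureTheory.volume 0 1 ∧
    ∫ u in (0 : ℝ)..1, (1 - u) * resolventForm U r V s u = spectralRel U r V s := by
  have hterm : ∀ i j,
      IntervalIntegrable (fun u => Complex.normSq ((Uᴴ * V) i j) *
        ((1 - u) * ((r i - s j) ^ 2 / (u * r i + (1 - u) * s j)))) MeasureTheory.volume 0 1 ∧
      ∫ u in (0 : ℝ)..1, Complex.normSq ((Uᴴ * V) i j) *
        ((1 - u) * ((r i - s j) ^ 2 / (u * r i + (1 - u) * s j))) =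
        Complex.normSq ((Uᴴ * V) i j) * relTerm (r i) (s j) := fun i j => by
    by_cases hw : (Uᴴ * V) i j = 0
    · simp [hw]
    · have h := relTerm_integral (hr i) (hs j) (hsupp i j hw)
      refine ⟨h.1.const_mul _, ?_⟩
      rw [intervalIntegral.integral_const_mul, h.2]
  have hfun : (fun u => (1 - u) * resolventForm U r V s u) = fun u => ∑ i, ∑ j,
      Complex.normSq ((Uᴴ * V) i j) *
        ((1 - u) * ((r i - s j) ^ 2 / (u * r i + (1 - u) * s j))) := by
    funext u
    simp only [resolventForm, Finset.mul_sum]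
    exact Finset.sum_congr rfl fun i _ => Finset.sum_congr rfl fun j _ => by ring
  have hInt : ∀ i, IntervalIntegrable (fun u => ∑ j, Complex.normSq ((Uᴴ * V) i j) *
        ((1 - u) * ((r i - s j) ^ 2 / (u * r i + (1 - u) * s j)))) MeasureTheory.volume 0 1 :=
    fun i => by
      simpa only [Finset.sum_fn] using IntervalIntegrable.sum Finset.univ fun j _ => (hterm i j).1
  rw [hfun]
  refine ⟨by simpa only [Finset.sum_fn] using
    IntervalIntegrable.sum Finset.univ fun i _ => hInt i, ?_⟩
  rw [intervalIntegral.integral_finsetSum fun i _ => hInt i, spectralRel]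
  refine Finset.sum_congr rfl fun i _ => ?_
  rw [intervalIntegral.integral_finsetSum fun j _ => (hterm i j).1]
  exact Finset.sum_congr rfl fun j _ => (hterm i j).2

/-- Joint subadditivity (equivalently, joint convexity) of the relative entropy. -/
theorem spectralRel_sum_le [Fintype κ] {U V : Matrix ι ι ℂ} {r s : ι → ℝ}
    {ρ σ : κ → Matrix ι ι ℂ} {U' V' : κ → Matrix ι ι ℂ} {r' s' : κ → ι → ℝ}
    (hρ : Diagonalizes U r (∑ k, ρ k)) (hσ : Diagonalizes V s (∑ k, σ k))
    (hr : ∀ i, 0 ≤ r i) (hs : ∀ i, 0 ≤ s i) (hsupp : SupportLE U r V s)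
    (hρ' : ∀ k, Diagonalizes (U' k) (r' k) (ρ k)) (hσ' : ∀ k, Diagonalizes (V' k) (s' k) (σ k))
    (hr' : ∀ k i, 0 ≤ r' k i) (hs' : ∀ k i, 0 ≤ s' k i)
    (hsupp' : ∀ k, SupportLE (U' k) (r' k) (V' k) (s' k)) :
    spectralRel U r V s ≤ ∑ k, spectralRel (U' k) (r' k) (V' k) (s' k) := by
  have h := spectralRel_integral hr hs hsupp
  have h' := fun k => spectralRel_integral (hr' k) (hs' k) (hsupp' k)
  rw [← h.2]
  simp only [← (h' _).2]
  rw [← intervalIntegral.integral_finsetSum fun k _ => (h' k).1]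
  refine intervalIntegral.integral_mono_on_of_le_Ioo zero_le_one h.1
    (by simpa only [Finset.sum_fn] using IntervalIntegrable.sum Finset.univ fun k _ => (h' k).1)
    fun u hu => ?_
  rw [← Finset.mul_sum]
  refine mul_le_mul_of_nonneg_left ?_ (sub_nonneg.2 hu.2.le)
  obtain ⟨Z, hZ⟩ := exists_quadForm_eq_resolventForm hρ hσ u
  rw [← hZ, quadForm_sum]
  exact Finset.sum_le_sum fun k _ =>
    quadForm_le_resolventForm (hρ' k) (hσ' k) (hr' k) (hs' k) hu Z

omit [DecidableEq ι] in
lemma spectralRel_nonneg {U V : Matrix ι ι ℂ} {r s : ι → ℝ} (hr : ∀ i, 0 ≤ r i)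
    (hs : ∀ i, 0 ≤ s i) (hsupp : SupportLE U r V s) : 0 ≤ spectralRel U r V s := by
  refine Finset.sum_nonneg fun i _ => Finset.sum_nonneg fun j _ => ?_
  by_cases hw : (Uᴴ * V) i j = 0
  · simp [hw]
  · exact mul_nonneg (Complex.normSq_nonneg _) (relTerm_nonneg (hr i) (hs j) (hsupp i j hw))

end RelativeEntropy

section SpectralFormula

variable {ι : Type*} [Fintype ι] [DecidableEq ι]

lemma sum_normSq_row {W : Matrix ι ι ℂ} (hW : W * Wᴴ = 1) (i : ι) :
    ∑ j, Complex.normSq (W i j) = 1 := by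
  have h := congrFun (congrFun hW i) i
  rw [Matrix.mul_apply, one_apply_eq] at h
  simp only [conjTranspose_apply, Complex.star_def, Complex.mul_conj] at h
  exact_mod_cast h

lemma sum_normSq_col {W : Matrix ι ι ℂ} (hW : Wᴴ * W = 1) (j : ι) :
    ∑ i, Complex.normSq (W i j) = 1 := by
  have h := congrFun (congrFun hW j) j
  rw [Matrix.mul_apply, one_apply_eq] at h
  simp only [conjTranspose_apply, Complex.star_def, ← Complex.normSq_eq_conj_mul_self] at h
  exact_mod_cast h

variable {U V ρ : Matrix ι ι ℂ} {r s : ι → ℝ}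

lemma Diagonalizes.re_conj_diag (hρ : Diagonalizes U r ρ) (V : Matrix ι ι ℂ) (j : ι) :
    ((Vᴴ * ρ * V) j j).re = ∑ i, Complex.normSq ((Uᴴ * V) i j) * r i := by
  have h : Vᴴ * ρ * V = (Uᴴ * V)ᴴ * (diagonal (fun i => (r i : ℂ)) * (Uᴴ * V)) := by
    rw [hρ.eq, conjTranspose_mul, conjTranspose_conjTranspose]
    simp only [Matrix.mul_assoc]
  rw [h, Matrix.mul_apply, Complex.re_sum]
  refine Finset.sum_congr rfl fun i _ => ?_
  simp only [conjTranspose_apply, diagonal_mul, Complex.star_def, Complex.mul_re, Complex.mul_im,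
    Complex.conj_re, Complex.conj_im, Complex.ofReal_re, Complex.ofReal_im, Complex.normSq_apply]
  ring

lemma Diagonalizes.supportLE (hρ : Diagonalizes U r ρ) (hr : ∀ i, 0 ≤ r i)
    (h : ∀ j, s j = 0 → ((Vᴴ * ρ * V) j j).re = 0) : SupportLE U r V s := by
  intro i j hij hj
  have h0 := h j hj
  rw [hρ.re_conj_diag] at h0
  have := (Finset.sum_eq_zero_iff_of_nonneg fun i _ =>
    mul_nonneg (Complex.normSq_nonneg ((Uᴴ * V) i j)) (hr i)).1 h0 i (Finset.mem_univ i)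
  exact (mul_eq_zero.1 this).resolve_left (by simpa using hij)

lemma Diagonalizes.spectralRel_eq (hρ : Diagonalizes U r ρ) (hV : Vᴴ * V = 1) (s : ι → ℝ) :
    spectralRel U r V s = -∑ i, Real.negMulLog (r i)
      - ∑ j, ((Vᴴ * ρ * V) j j).re * Real.log (s j) - ∑ i, r i + ∑ j, s j := by
  have hV' := mul_eq_one_comm.mp hV
  have hrow : (Uᴴ * V) * (Uᴴ * V)ᴴ = 1 := by
    rw [conjTranspose_mul, conjTranspose_conjTranspose, Matrix.mul_assoc, ← Matrix.mul_assoc V,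
      hV', Matrix.one_mul, hρ.unitary]
  have hcol := mul_eq_one_comm.mp hrow
  have e1 : ∑ i, Real.negMulLog (r i) =
      ∑ i, ∑ j, Complex.normSq ((Uᴴ * V) i j) * Real.negMulLog (r i) :=
    Finset.sum_congr rfl fun i _ => by rw [← Finset.sum_mul, sum_normSq_row hrow, one_mul]
  have e2 : ∑ i, r i = ∑ i, ∑ j, Complex.normSq ((Uᴴ * V) i j) * r i :=
    Finset.sum_congr rfl fun i _ => by rw [← Finset.sum_mul, sum_normSq_row hrow, one_mul]
  have e3 : ∑ j, s j = ∑ i, ∑ j, Complex.normSq ((Uᴴ * V) i j) * s j := by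
    rw [Finset.sum_comm]
    exact Finset.sum_congr rfl fun j _ => by rw [← Finset.sum_mul, sum_normSq_col hcol, one_mul]
  have e4 : ∑ j, ((Vᴴ * ρ * V) j j).re * Real.log (s j) =
      ∑ i, ∑ j, Complex.normSq ((Uᴴ * V) i j) * r i * Real.log (s j) := by
    rw [Finset.sum_comm]
    exact Finset.sum_congr rfl fun j _ => by rw [hρ.re_conj_diag, Finset.sum_mul]
  rw [e1, e2, e3, e4, spectralRel]
  simp only [← Finset.sum_neg_distrib, ← Finset.sum_sub_distrib, ← Finset.sum_add_distrib]
  refine Finset.sum_congr rfl fun i _ => Finset.sum_congr rfl fun j _ => ?_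
  rw [relTerm]
  ring

lemma spectralRel_self (hU : Uᴴ * U = 1) : spectralRel U r U s = ∑ i, relTerm (r i) (s i) := by
  rw [spectralRel, hU]
  refine Finset.sum_congr rfl fun i _ => ?_
  rw [Finset.sum_eq_single i (fun j _ hj => by simp [one_apply_ne hj.symm]) (by simp)]
  simp

end SpectralFormula

section Bipartite

variable {α β : Type*}

lemma posSemidef_ptrR [Fintype β] {ρ : Matrix (α × β) (α × β) ℂ} (h : ρ.PosSemidef) :
    (ptrR ρ).PosSemidef := by
  have : ptrR ρ = ∑ b, ρ.submatrix (fun a => (a, b)) (fun a => (a, b)) := by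
    ext a a'
    simp [ptrR, Matrix.sum_apply]
  rw [this]
  exact posSemidef_sum _ fun b _ => h.submatrix _

lemma posSemidef_ptrL [Fintype α] {ρ : Matrix (α × β) (α × β) ℂ} (h : ρ.PosSemidef) :
    (ptrL ρ).PosSemidef :=
  posSemidef_ptrR (ρ := ρ.submatrix Prod.swap Prod.swap) (h.submatrix _)

variable [Fintype α] [Fintype β]

lemma trace_ptrR (ρ : Matrix (α × β) (α × β) ℂ) : (ptrR ρ).trace = ρ.trace := by
  simp [trace, ptrR, Fintype.sum_prod_type]

lemma trace_ptrL (ρ : Matrix (α × β) (α × β) ℂ) : (ptrL ρ).trace = ρ.trace := by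
  simp [trace, ptrL, Fintype.sum_prod_type_right]

variable [DecidableEq α] [DecidableEq β]

omit [DecidableEq α] in
lemma ptrR_kronecker_one_mul (X : Matrix α α ℂ) (ρ : Matrix (α × β) (α × β) ℂ) :
    ptrR ((X ⊗ₖ (1 : Matrix β β ℂ)) * ρ) = X * ptrR ρ := by
  ext a a'
  simp only [ptrR, of_apply, Matrix.mul_apply, kroneckerMap_apply, one_apply, mul_ite, mul_one,
    mul_zero, ite_mul, zero_mul, Fintype.sum_prod_type, Finset.sum_ite_eq, Finset.mem_univ,
    if_true, Finset.mul_sum]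
  exact Finset.sum_comm

omit [DecidableEq α] in
lemma ptrR_mul_kronecker_one (X : Matrix α α ℂ) (ρ : Matrix (α × β) (α × β) ℂ) :
    ptrR (ρ * (X ⊗ₖ (1 : Matrix β β ℂ))) = ptrR ρ * X := by
  ext a a'
  simp only [ptrR, of_apply, Matrix.mul_apply, kroneckerMap_apply, one_apply, mul_ite, mul_one,
    mul_zero, Fintype.sum_prod_type, Finset.sum_ite_eq', Finset.mem_univ,
    if_true, Finset.sum_mul]
  exact Finset.sum_comm

omit [DecidableEq β] in
lemma ptrR_one_kronecker_mul_comm (Y : Matrix β β ℂ) (ρ : Matrix (α × β) (α × β) ℂ) :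
    ptrR (((1 : Matrix α α ℂ) ⊗ₖ Y) * ρ) = ptrR (ρ * ((1 : Matrix α α ℂ) ⊗ₖ Y)) := by
  ext a a'
  simp only [ptrR, of_apply, Matrix.mul_apply, kroneckerMap_apply, one_apply, mul_ite, ite_mul,
    one_mul, zero_mul, mul_zero, Fintype.sum_prod_type_right, Finset.sum_ite_eq,
    Finset.sum_ite_eq', Finset.mem_univ, if_true]
  rw [Finset.sum_comm]
  exact Finset.sum_congr rfl fun _ _ => Finset.sum_congr rfl fun _ _ => mul_comm _ _

lemma ptrR_kronecker_conj (X : Matrix α α ℂ) {Y : Matrix β β ℂ} (hY : Yᴴ * Y = 1)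
    (ρ : Matrix (α × β) (α × β) ℂ) :
    ptrR ((X ⊗ₖ Y)ᴴ * ρ * (X ⊗ₖ Y)) = Xᴴ * ptrR ρ * X := by
  have h1 : X ⊗ₖ Y = (X ⊗ₖ (1 : Matrix β β ℂ)) * ((1 : Matrix α α ℂ) ⊗ₖ Y) := by
    rw [← mul_kronecker_mul, Matrix.mul_one, Matrix.one_mul]
  have h2 : (X ⊗ₖ Y)ᴴ = ((1 : Matrix α α ℂ) ⊗ₖ Yᴴ) * (Xᴴ ⊗ₖ (1 : Matrix β β ℂ)) := by
    rw [conjTranspose_kronecker, ← mul_kronecker_mul, Matrix.mul_one, Matrix.one_mul]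
  rw [h2, Matrix.mul_assoc, Matrix.mul_assoc, ptrR_one_kronecker_mul_comm, h1]
  simp only [Matrix.mul_assoc]
  rw [← mul_kronecker_mul, mul_eq_one_comm.mp hY, Matrix.one_mul, one_kronecker_one,
    Matrix.mul_one, ptrR_kronecker_one_mul, ptrR_mul_kronecker_one]

lemma ptrL_kronecker_conj {X : Matrix α α ℂ} (hX : Xᴴ * X = 1) (Y : Matrix β β ℂ)
    (ρ : Matrix (α × β) (α × β) ℂ) :
    ptrL ((X ⊗ₖ Y)ᴴ * ρ * (X ⊗ₖ Y)) = Yᴴ * ptrL ρ * Y := by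
  have h : (X ⊗ₖ Y).submatrix (Equiv.prodComm β α) (Equiv.prodComm β α) = Y ⊗ₖ X := by
    ext a b
    simp [mul_comm]
  have e (M : Matrix (α × β) (α × β) ℂ) :
      ptrL M = ptrR (M.submatrix (Equiv.prodComm β α) (Equiv.prodComm β α)) := rfl
  rw [e, e, ← submatrix_mul_equiv _ _ _ (Equiv.prodComm β α),
    ← submatrix_mul_equiv _ _ _ (Equiv.prodComm β α), ← conjTranspose_submatrix, h,
    ptrR_kronecker_conj Y hX]

variable {ρ : Matrix (α × β) (α × β) ℂ} {X : Matrix α α ℂ} {Y : Matrix β β ℂ}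
  {a : α → ℝ} {b : β → ℝ}

lemma Diagonalizes.sum_marginal_right (hX : Diagonalizes X a (ptrR ρ)) (hY : Yᴴ * Y = 1) (i : α) :
    ∑ j, (((X ⊗ₖ Y)ᴴ * ρ * (X ⊗ₖ Y)) (i, j) (i, j)).re = a i := by
  have h := congrArg Complex.re
    (congrFun (congrFun ((ptrR_kronecker_conj X hY ρ).trans hX.conj_eq) i) i)
  simpa [ptrR] using h

lemma Diagonalizes.sum_marginal_left (hX : Xᴴ * X = 1) (hY : Diagonalizes Y b (ptrL ρ)) (j : β) :
    ∑ i, (((X ⊗ₖ Y)ᴴ * ρ * (X ⊗ₖ Y)) (i, j) (i, j)).re = b j := by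
  have h := congrArg Complex.re
    (congrFun (congrFun ((ptrL_kronecker_conj hX Y ρ).trans hY.conj_eq) j) j)
  simpa [ptrL] using h

lemma Diagonalizes.sum_eq_one {ι : Type*} [Fintype ι] [DecidableEq ι] {U τ : Matrix ι ι ℂ}
    {r : ι → ℝ} (h : Diagonalizes U r τ) (htr : τ.trace = 1) : ∑ i, r i = 1 := by
  have := h.trace_eq
  rw [htr] at this
  exact_mod_cast this.symm

lemma re_conj_diag_nonneg {ι : Type*} [Fintype ι] [DecidableEq ι] {τ : Matrix ι ι ℂ}
    (h : τ.PosSemidef) (W : Matrix ι ι ℂ) (i : ι) : 0 ≤ ((Wᴴ * τ * W) i i).re :=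
  (Complex.nonneg_iff.1 (h.conjTranspose_mul_mul_same W).diag_nonneg).1

/-- Subadditivity of the von Neumann entropy. -/
theorem entropy_le_add (hρ : IsState ρ) : entropy ρ ≤ entropy (ptrR ρ) + entropy (ptrL ρ) := by
  have hR := posSemidef_ptrR hρ.1
  have hL := posSemidef_ptrL hρ.1
  have dρ := hρ.1.1.diagonalizes
  have dR := hR.1.diagonalizes
  have dL := hL.1.diagonalizes
  rw [dρ.entropy_eq, dR.entropy_eq, dL.entropy_eq, ← add_div]
  have hr := hρ.1.eigenvalues_nonneg
  have ha := hR.eigenvalues_nonneg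
  have hb := hL.eigenvalues_nonneg
  generalize (hρ.1.1.eigenvectorUnitary : Matrix (α × β) (α × β) ℂ) = U at dρ
  generalize (hR.1.eigenvectorUnitary : Matrix α α ℂ) = X at dR
  generalize (hL.1.eigenvectorUnitary : Matrix β β ℂ) = Y at dL
  generalize hρ.1.1.eigenvalues = r at *
  generalize hR.1.eigenvalues = a at *
  generalize hL.1.eigenvalues = b at *
  have hd := re_conj_diag_nonneg hρ.1 (X ⊗ₖ Y)
  have sR := dR.sum_marginal_right dL.unitary
  have sL := Diagonalizes.sum_marginal_left dR.unitary dL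
  have zR : ∀ i j, a i = 0 → (((X ⊗ₖ Y)ᴴ * ρ * (X ⊗ₖ Y)) (i, j) (i, j)).re = 0 := fun i j h =>
    (Finset.sum_eq_zero_iff_of_nonneg fun j _ => hd (i, j)).1 ((sR i).trans h) j
      (Finset.mem_univ j)
  have zL : ∀ i j, b j = 0 → (((X ⊗ₖ Y)ᴴ * ρ * (X ⊗ₖ Y)) (i, j) (i, j)).re = 0 := fun i j h =>
    (Finset.sum_eq_zero_iff_of_nonneg fun i _ => hd (i, j)).1 ((sL j).trans h) i
      (Finset.mem_univ i)
  have hunit : (X ⊗ₖ Y)ᴴ * (X ⊗ₖ Y) = 1 := by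
    rw [conjTranspose_kronecker, ← mul_kronecker_mul, dR.unitary, dL.unitary, one_kronecker_one]
  have key := spectralRel_nonneg (s := fun k : α × β => a k.1 * b k.2) hr
    (fun k => mul_nonneg (ha k.1) (hb k.2)) (dρ.supportLE (V := X ⊗ₖ Y) hr fun k hk => by
      rcases mul_eq_zero.1 hk with h | h
      · exact zR k.1 k.2 h
      · exact zL k.1 k.2 h)
  rw [dρ.spectralRel_eq hunit, dρ.sum_eq_one hρ.2] at key
  have hs : ∑ k : α × β, a k.1 * b k.2 = 1 := by
    rw [Fintype.sum_prod_type]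
    simp only [← Finset.mul_sum]
    rw [dL.sum_eq_one ((trace_ptrL ρ).trans hρ.2)]
    simp [dR.sum_eq_one ((trace_ptrR ρ).trans hρ.2)]
  have hlog : ∑ k : α × β, (((X ⊗ₖ Y)ᴴ * ρ * (X ⊗ₖ Y)) k k).re * Real.log (a k.1 * b k.2) =
      -∑ i, Real.negMulLog (a i) - ∑ j, Real.negMulLog (b j) := by
    have h1 : ∀ k : α × β, (((X ⊗ₖ Y)ᴴ * ρ * (X ⊗ₖ Y)) k k).re * Real.log (a k.1 * b k.2) =
        (((X ⊗ₖ Y)ᴴ * ρ * (X ⊗ₖ Y)) k k).re * Real.log (a k.1) +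
          (((X ⊗ₖ Y)ᴴ * ρ * (X ⊗ₖ Y)) k k).re * Real.log (b k.2) := by
      rintro ⟨i, j⟩
      by_cases hi : a i = 0
      · simp [zR i j hi]
      by_cases hj : b j = 0
      · simp [zL i j hj]
      rw [Real.log_mul hi hj, mul_add]
    rw [Finset.sum_congr rfl fun k _ => h1 k, Finset.sum_add_distrib, Fintype.sum_prod_type,
      Fintype.sum_prod_type_right]
    simp only [← Finset.sum_mul, sR, sL, Real.negMulLog, neg_mul, Finset.sum_neg_distrib]
    ring
  rw [hs, hlog] at key
  exact div_le_div_of_nonneg_right (by linarith) (Real.log_nonneg one_le_two)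

lemma relTerm_mul {q t l : ℝ} : relTerm (q * (l * t)) (q * (1 * t)) =
    q * (t * (-Real.negMulLog l - l + 1)) := by
  by_cases h : q * t = 0
  · rcases mul_eq_zero.1 h with rfl | rfl <;> simp [relTerm]
  · have hq := left_ne_zero_of_mul h
    have ht := right_ne_zero_of_mul h
    by_cases hl : l = 0
    · simp [relTerm, hl]
    simp only [relTerm, Real.negMulLog, one_mul]
    rw [Real.log_mul hq (mul_ne_zero hl ht), Real.log_mul hl ht, Real.log_mul hq ht]
    ring

omit [Fintype β] [DecidableEq α] [DecidableEq β] in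
lemma ptrL_sum_smul_kronecker {κ : Type*} [Fintype κ] (q : κ → ℝ) (σ : κ → Matrix α α ℂ)
    (τ : κ → Matrix β β ℂ) (hσ : ∀ y, (σ y).trace = 1) :
    ptrL (∑ y, (q y : ℂ) • (σ y ⊗ₖ τ y)) = ∑ y, (q y : ℂ) • τ y := by
  ext i j
  simp only [ptrL, of_apply, Matrix.sum_apply, Matrix.smul_apply, kroneckerMap_apply, smul_eq_mul]
  rw [Finset.sum_comm]
  refine Finset.sum_congr rfl fun y _ => ?_
  have h := hσ y
  simp only [trace, diag_apply] at h
  rw [← Finset.mul_sum, ← Finset.sum_mul, h, one_mul]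

omit [Fintype α] [DecidableEq α] [DecidableEq β] in
lemma ptrR_sum_smul_kronecker {κ : Type*} [Fintype κ] (q : κ → ℝ) (σ : κ → Matrix α α ℂ)
    (τ : κ → Matrix β β ℂ) (hτ : ∀ y, (τ y).trace = 1) :
    ptrR (∑ y, (q y : ℂ) • (σ y ⊗ₖ τ y)) = ∑ y, (q y : ℂ) • σ y := by
  ext i j
  simp only [ptrR, of_apply, Matrix.sum_apply, Matrix.smul_apply, kroneckerMap_apply, smul_eq_mul]
  rw [Finset.sum_comm]
  refine Finset.sum_congr rfl fun y _ => ?_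
  have h := hτ y
  simp only [trace, diag_apply] at h
  rw [← Finset.mul_sum, ← Finset.mul_sum, h, mul_one]

lemma IsState.sum_smul {ι κ : Type*} [Fintype ι] [Fintype κ] {q : κ → ℝ}
    (hq : IsProbDist q) {τ : κ → Matrix ι ι ℂ} (hτ : ∀ y, IsState (τ y)) :
    IsState (∑ y, (q y : ℂ) • τ y) := by
  refine ⟨posSemidef_sum _ fun y _ => (hτ y).1.smul (by exact_mod_cast hq.1 y), ?_⟩
  simp only [trace_sum, trace_smul, (hτ _).2, smul_eq_mul, mul_one]
  exact_mod_cast hq.2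

lemma IsState.kronecker {ι κ : Type*} [Fintype ι] [Fintype κ] {σ : Matrix ι ι ℂ}
    {τ : Matrix κ κ ℂ} (hσ : IsState σ) (hτ : IsState τ) : IsState (σ ⊗ₖ τ) :=
  ⟨hσ.1.kronecker hτ.1, by rw [trace_kronecker, hσ.2, hτ.2, one_mul]⟩

/-- Concavity of the conditional entropy on mixtures of product states. -/
theorem entropy_separable_ge {κ : Type*} [Fintype κ] {q : κ → ℝ} (hq : IsProbDist q)
    {σ : κ → Matrix α α ℂ} {τ : κ → Matrix β β ℂ} (hσ : ∀ y, IsState (σ y))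
    (hτ : ∀ y, IsState (τ y)) :
    entropy (∑ y, (q y : ℂ) • τ y) + ∑ y, q y * entropy (σ y) ≤
      entropy (∑ y, (q y : ℂ) • (σ y ⊗ₖ τ y)) := by
  have hρ : IsState (∑ y, (q y : ℂ) • (σ y ⊗ₖ τ y)) :=
    IsState.sum_smul hq fun y => (hσ y).kronecker (hτ y)
  have hE : IsState (∑ y, (q y : ℂ) • τ y) := IsState.sum_smul hq hτ
  have hL := ptrL_sum_smul_kronecker q σ τ fun y => (hσ y).2
  have dρ := hρ.1.1.diagonalizes
  have dE := hE.1.1.diagonalizes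
  have dσ := fun y => (hσ y).1.1.diagonalizes
  have dτ := fun y => (hτ y).1.1.diagonalizes
  have hr := hρ.1.eigenvalues_nonneg
  have he := hE.1.eigenvalues_nonneg
  have hl := fun y => (hσ y).1.eigenvalues_nonneg
  have ht := fun y => (hτ y).1.eigenvalues_nonneg
  simp only [fun y => (dσ y).entropy_eq]
  rw [dρ.entropy_eq, dE.entropy_eq]
  simp only [mul_div_assoc']
  rw [← Finset.sum_div, ← add_div]
  refine div_le_div_of_nonneg_right ?_ (Real.log_nonneg one_le_two)
  have hone : (1 : Matrix α α ℂ)ᴴ * 1 = 1 := by simp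
  have dV := (Diagonalizes.one hone).kronecker dE
  have hsum : ∑ y, (q y : ℂ) • ((1 : Matrix α α ℂ) ⊗ₖ τ y) = 1 ⊗ₖ ∑ y, (q y : ℂ) • τ y := by
    ext i j
    simp only [Matrix.sum_apply, Matrix.smul_apply, kroneckerMap_apply, smul_eq_mul,
      Finset.mul_sum]
    exact Finset.sum_congr rfl fun y _ => by ring
  rw [← hsum] at dV
  have hd := re_conj_diag_nonneg hρ.1
    ((1 : Matrix α α ℂ) ⊗ₖ (hE.1.1.eigenvectorUnitary : Matrix β β ℂ))
  have dL : Diagonalizes (hE.1.1.eigenvectorUnitary : Matrix β β ℂ) hE.1.1.eigenvalues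
      (ptrL (∑ y, (q y : ℂ) • (σ y ⊗ₖ τ y))) := ⟨dE.unitary, hL.trans dE.eq⟩
  have sL := Diagonalizes.sum_marginal_left hone dL
  have hsupp := dρ.supportLE (s := fun k : α × β => 1 * hE.1.1.eigenvalues k.2)
    (V := (1 : Matrix α α ℂ) ⊗ₖ (hE.1.1.eigenvectorUnitary : Matrix β β ℂ)) hr fun k hk =>
      (Finset.sum_eq_zero_iff_of_nonneg fun i _ => hd (i, k.2)).1
        ((sL k.2).trans (by simpa using hk)) k.1 (Finset.mem_univ _)
  have dk := fun y => ((dσ y).kronecker (dτ y)).smul (q y)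
  have dk' := fun y => ((Diagonalizes.one (dσ y).unitary).kronecker (dτ y)).smul (q y)
  have key := spectralRel_sum_le dρ dV hr (fun k => by simpa using he k.2) hsupp dk dk'
    (fun y k => mul_nonneg (hq.1 y) (mul_nonneg (hl y k.1) (ht y k.2)))
    (fun y k => mul_nonneg (hq.1 y) (mul_nonneg zero_le_one (ht y k.2)))
    (fun y i j hij hj => by
      rw [(dk y).unitary] at hij
      obtain rfl : i = j := by
        by_contra h
        exact hij (one_apply_ne h)
      rcases mul_eq_zero.1 hj with h | h
      · simp [h]
      · simp [(mul_eq_zero.1 h).resolve_left one_ne_zero])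
  rw [dρ.spectralRel_eq dV.unitary, dρ.sum_eq_one hρ.2] at key
  have hterm : ∀ y, ∑ k : α × β, q y * ((hτ y).1.1.eigenvalues k.2 *
      (-Real.negMulLog ((hσ y).1.1.eigenvalues k.1) - (hσ y).1.1.eigenvalues k.1 + 1)) =
      q y * (Fintype.card α - 1) -
        q y * ∑ i, Real.negMulLog ((hσ y).1.1.eigenvalues i) := fun y => by
    rw [← Finset.mul_sum, Fintype.sum_prod_type]
    simp only [← Finset.sum_mul]
    simp only [(dτ y).sum_eq_one (hτ y).2, one_mul, Finset.sum_add_distrib,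
      Finset.sum_sub_distrib, Finset.sum_neg_distrib, (dσ y).sum_eq_one (hσ y).2]
    simp
    ring
  replace key := key.trans_eq (Finset.sum_congr rfl fun y _ =>
    (spectralRel_self (dk y).unitary).trans
      ((Finset.sum_congr rfl fun k _ => relTerm_mul).trans (hterm y)))
  have hcross := Finset.sum_congr rfl fun j (_ : j ∈ Finset.univ) =>
    (Finset.sum_mul _ _ _).symm.trans
      (congrArg (· * Real.log (1 * hE.1.1.eigenvalues j)) (sL j))
  have hcard : ∑ k : α × β, 1 * hE.1.1.eigenvalues k.2 = Fintype.card α := by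
    simp [Fintype.sum_prod_type, dE.sum_eq_one hE.2]
  rw [Finset.sum_sub_distrib, ← Finset.sum_mul, hq.2, hcard,
    Fintype.sum_prod_type_right fun k : α × β => _ * Real.log (1 * hE.1.1.eigenvalues k.2),
    hcross] at key
  have hE' : ∑ j, hE.1.1.eigenvalues j * Real.log (1 * hE.1.1.eigenvalues j) =
      -∑ j, Real.negMulLog (hE.1.1.eigenvalues j) := by
    simp [Real.negMulLog]
  rw [hE'] at key
  linarith

end Bipartite

section Channels

variable {α β γ : Type*}

lemma rTensor_kronecker (L : Matrix α α ℂ →ₗ[ℂ] Matrix β β ℂ) (σ : Matrix α α ℂ)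
    (τ : Matrix γ γ ℂ) : rTensor γ L (σ ⊗ₖ τ) = L σ ⊗ₖ τ := by
  ext p q
  have h : (of fun a a' => (σ ⊗ₖ τ) (a, p.2) (a', q.2)) = τ p.2 q.2 • σ := by
    ext a a'
    simp [mul_comm]
  change L (of fun a a' => (σ ⊗ₖ τ) (a, p.2) (a', q.2)) p.1 q.1 = _
  rw [h, map_smul, Matrix.smul_apply, kroneckerMap_apply, smul_eq_mul, mul_comm]

variable [Fintype α] [DecidableEq α] [Fintype β] [DecidableEq β]

lemma QChannel.isState_map (N : QChannel α β) {σ : Matrix α α ℂ} (hσ : IsState σ) :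
    IsState (N.map σ) :=
  ⟨(N.cp 1 (σ.submatrix Prod.snd Prod.snd) (hσ.1.submatrix _)).submatrix (fun b => (0, b)),
    (N.tp σ).trans hσ.2⟩

/-- The channel discarding its input and preparing the state `σ`. -/
def QChannel.replacer (α : Type*) [Fintype α] [DecidableEq α] {σ : Matrix β β ℂ}
    (hσ : IsState σ) : QChannel α β where
  map := (traceLinearMap α ℂ ℂ).smulRight σ
  cp n ρ hρ := by
    have h : lTensor (Fin n) ((traceLinearMap α ℂ ℂ).smulRight σ) ρ = ptrR ρ ⊗ₖ σ := rfl
    rw [h]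
    exact (posSemidef_ptrR hρ).kronecker hσ.1
  tp ρ := by simp [trace_smul, hσ.2]

lemma QChannel.replacer_map {σ : Matrix β β ℂ} (hσ : IsState σ) {ρ : Matrix α α ℂ}
    (hρ : ρ.trace = 1) : (QChannel.replacer α hσ).map ρ = σ := by
  simp [QChannel.replacer, hρ]

lemma entropy_kronecker {σ : Matrix α α ℂ} {τ : Matrix β β ℂ} (hσ : IsState σ)
    (hτ : IsState τ) : entropy (σ ⊗ₖ τ) = entropy σ + entropy τ := by
  have dσ := hσ.1.1.diagonalizes
  have dτ := hτ.1.1.diagonalizes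
  rw [(dσ.kronecker dτ).entropy_eq, dσ.entropy_eq, dτ.entropy_eq, ← add_div]
  congr 1
  simp only [Real.negMulLog_mul, Fintype.sum_prod_type, Finset.sum_add_distrib]
  simp only [← Finset.sum_mul, ← Finset.mul_sum, dσ.sum_eq_one hσ.2, dτ.sum_eq_one hτ.2, one_mul]

end Channels

section SeparableAssistance

variable {EA EB A B κ : Type*} [Fintype EA] [DecidableEq EA] [Fintype EB] [DecidableEq EB]
  [Fintype A] [DecidableEq A] [Fintype B] [DecidableEq B]

omit [Fintype EB] [DecidableEq EB] in
lemma assistedOut_sum_smul_kronecker [Fintype κ] (N : QChannel A B) (E : QChannel EA A)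
    (q : κ → ℝ) (σ : κ → Matrix EA EA ℂ) (τ : κ → Matrix EB EB ℂ) :
    assistedOut N E (∑ y, (q y : ℂ) • (σ y ⊗ₖ τ y)) =
      ∑ y, (q y : ℂ) • (N.map (E.map (σ y)) ⊗ₖ τ y) := by
  simp only [assistedOut, map_sum, map_smul, rTensor_kronecker, LinearMap.comp_apply]

omit [Fintype EB] [DecidableEq EB] [DecidableEq B] in
lemma margXE_cqState {ι : Type*} [DecidableEq ι] (p : ι → ℝ)
    (ω : ι → Matrix (B × EB) (B × EB) ℂ) :
    margXE (cqState p ω) = cqState p fun x => ptrL (ω x) := by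
  ext a b
  by_cases h : a.1 = b.1 <;> simp [margXE, cqState, ptrL, h, Finset.mul_sum]

lemma infoXE_B_cqState {ι : Type*} [Fintype ι] [DecidableEq ι] {p : ι → ℝ} (hp : IsProbDist p)
    {ω : ι → Matrix (B × EB) (B × EB) ℂ} (hω : ∀ x, IsState (ω x)) {η : Matrix EB EB ℂ}
    (hη : ∀ x, ptrL (ω x) = η) :
    infoXE_B (cqState p ω) =
      entropy η + entropy (ptrR (∑ x, (p x : ℂ) • ω x)) - ∑ x, p x * entropy (ω x) := by
  have h1 : entropy (cqState p fun x => ptrL (ω x)) =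
      (∑ x, Real.negMulLog (p x)) / Real.log 2 + entropy η := by
    rw [entropy_cqState (fun x => (posSemidef_ptrL (hω x).1).1)
      fun x => (trace_ptrL _).trans (hω x).2]
    simp only [hη, ← Finset.sum_mul, hp.2, one_mul]
  rw [infoXE_B, margXE_cqState, h1, ptrL_cqState,
    entropy_cqState (fun x => (hω x).1.1) fun x => (hω x).2]
  ring

omit [Fintype EB] [DecidableEq EB] [DecidableEq B] in
lemma ptrL_sum_smul_eq {ι : Type*} [Fintype ι] {p : ι → ℝ} (hp : IsProbDist p)
    {ω : ι → Matrix (B × EB) (B × EB) ℂ} {η : Matrix EB EB ℂ} (hη : ∀ x, ptrL (ω x) = η) :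
    ptrL (∑ x, (p x : ℂ) • ω x) = η := by
  have h : ptrL (∑ x, (p x : ℂ) • ω x) = ∑ x, (p x : ℂ) • ptrL (ω x) := by
    ext i j
    simp only [ptrL, of_apply, Matrix.sum_apply, Matrix.smul_apply, Finset.smul_sum]
    exact Finset.sum_comm
  rw [h]
  simp only [hη, ← Finset.sum_smul]
  rw [← Complex.ofReal_sum, hp.2, Complex.ofReal_one, one_smul]

/-- If every conditional state has the same marginal on `E_B`, then
`I(X : B E_B) ≤ I(X E_B : B)`. -/
lemma mutualInfoS_le_infoXE_B {ι : Type*} [Fintype ι] [DecidableEq ι] {p : ι → ℝ}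
    (hp : IsProbDist p) {ω : ι → Matrix (B × EB) (B × EB) ℂ} (hω : ∀ x, IsState (ω x))
    {η : Matrix EB EB ℂ} (hη : ∀ x, ptrL (ω x) = η) :
    mutualInfoS (cqState p ω) ≤ infoXE_B (cqState p ω) := by
  rw [infoXE_B_cqState hp hω hη, mutualInfoS_cqState (fun x => (hω x).1.1) fun x => (hω x).2]
  have := entropy_le_add (IsState.sum_smul hp hω)
  rw [ptrL_sum_smul_eq hp hη] at this
  linarith

lemma IsProbDist.prod {n m : ℕ} {p : Fin n → ℝ} {q : Fin m → ℝ} (hp : IsProbDist p)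
    (hq : IsProbDist q) :
    IsProbDist fun k : Fin (n * m) =>
      p (finProdFinEquiv.symm k).1 * q (finProdFinEquiv.symm k).2 := by
  refine ⟨fun k => mul_nonneg (hp.1 _) (hq.1 _), ?_⟩
  rw [Equiv.sum_comp finProdFinEquiv.symm fun k : Fin n × Fin m => p k.1 * q k.2,
    Fintype.sum_prod_type]
  simp only [← Finset.mul_sum, hq.2, mul_one, hp.2]

/-- With a separable assisting state, `I(X E_B : B)` is at most the Holevo information of the
ensemble of channel outputs indexed by the pair of the message and the separable label. -/
lemma infoXE_B_le_mutualInfoS {n m : ℕ} {p : Fin n → ℝ} {q : Fin m → ℝ} (hp : IsProbDist p)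
    (hq : IsProbDist q) {σ : Fin n → Fin m → Matrix B B ℂ} {τ : Fin m → Matrix EB EB ℂ}
    (hσ : ∀ x y, IsState (σ x y)) (hτ : ∀ y, IsState (τ y)) :
    infoXE_B (cqState p fun x => ∑ y, (q y : ℂ) • (σ x y ⊗ₖ τ y)) ≤
      mutualInfoS (cqState
        (fun k : Fin (n * m) => p (finProdFinEquiv.symm k).1 * q (finProdFinEquiv.symm k).2)
        fun k => σ (finProdFinEquiv.symm k).1 (finProdFinEquiv.symm k).2) := by
  rw [infoXE_B_cqState hp (fun x => IsState.sum_smul hq fun y => (hσ x y).kronecker (hτ y))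
    fun x => ptrL_sum_smul_kronecker q (σ x) τ fun y => (hσ x y).2,
    mutualInfoS_cqState (fun k => (hσ _ _).1.1) fun k => (hσ _ _).2,
    Equiv.sum_comp finProdFinEquiv.symm
      fun k : Fin n × Fin m => ((p k.1 * q k.2 : ℝ) : ℂ) • σ k.1 k.2,
    Equiv.sum_comp finProdFinEquiv.symm
      fun k : Fin n × Fin m => p k.1 * q k.2 * entropy (σ k.1 k.2)]
  have hR : ptrR (∑ x, (p x : ℂ) • ∑ y, (q y : ℂ) • (σ x y ⊗ₖ τ y)) =
      ∑ k : Fin n × Fin m, ((p k.1 * q k.2 : ℝ) : ℂ) • σ k.1 k.2 := by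
    rw [← ptrR_sum_smul_kronecker _ _ (fun k : Fin n × Fin m => τ k.2) fun k => (hτ k.2).2,
      Fintype.sum_prod_type]
    simp only [Finset.smul_sum, smul_smul, Complex.ofReal_mul]
  have hS : ∑ x, p x * (entropy (∑ y, (q y : ℂ) • τ y) + ∑ y, q y * entropy (σ x y)) ≤
      ∑ x, p x * entropy (∑ y, (q y : ℂ) • (σ x y ⊗ₖ τ y)) :=
    Finset.sum_le_sum fun x _ =>
      mul_le_mul_of_nonneg_left (entropy_separable_ge hq (hσ x) hτ) (hp.1 x)
  simp only [mul_add, Finset.sum_add_distrib, ← Finset.sum_mul, hp.2, one_mul, Finset.mul_sum,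
    ← mul_assoc] at hS
  rw [hR, Fintype.sum_prod_type fun k : Fin n × Fin m => p k.1 * q k.2 * entropy (σ k.1 k.2)]
  linarith

lemma mutualInfoS_cqState_kronecker {ι : Type*} [Fintype ι] [DecidableEq ι] {p : ι → ℝ}
    (hp : IsProbDist p) {σ : ι → Matrix B B ℂ} {η : Matrix EB EB ℂ} (hσ : ∀ x, IsState (σ x))
    (hη : IsState η) :
    mutualInfoS (cqState p fun x => σ x ⊗ₖ η) = mutualInfoS (cqState p σ) := by
  have hs : ∑ x, (p x : ℂ) • (σ x ⊗ₖ η) = (∑ x, (p x : ℂ) • σ x) ⊗ₖ η := by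
    ext i j
    simp [Matrix.sum_apply, Finset.sum_mul, mul_assoc]
  rw [mutualInfoS_cqState (fun x => ((hσ x).kronecker hη).1.1) fun x => ((hσ x).kronecker hη).2,
    mutualInfoS_cqState (fun x => (hσ x).1.1) fun x => (hσ x).2, hs,
    entropy_kronecker (IsState.sum_smul hp hσ) hη]
  simp only [fun x => entropy_kronecker (hσ x) hη, mul_add, Finset.sum_add_distrib,
    ← Finset.sum_mul, hp.2, one_mul]
  ring

end SeparableAssistance

/-- separable assistance states give no advantage:
`χ_ρ(N) = I_ρ(N) = χ(N)` for every separable `ρ_{E_AE_B}`. -/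
theorem separable_assistance_useless
    {EA EB A B : Type*} [Fintype EA] [DecidableEq EA] [Fintype EB] [DecidableEq EB]
    [Fintype A] [DecidableEq A] [Fintype B] [DecidableEq B]
    (N : QChannel A B) (ρ : Matrix (EA × EB) (EA × EB) ℂ) (hρ : IsState ρ)
    (hsep : ∃ (n : ℕ) (p : Fin n → ℝ) (σ : Fin n → Matrix EA EA ℂ)
      (τ : Fin n → Matrix EB EB ℂ),
      IsProbDist p ∧ (∀ x, IsState (σ x)) ∧ (∀ x, IsState (τ x)) ∧
      ρ = ∑ x, (p x : ℂ) • (σ x ⊗ₖ τ x)) :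
    assistedHolevoS N ρ = holevoS N ∧ assistedMutualS N ρ = holevoS N := by
  obtain ⟨m, q, σ, τ, hq, hσ, hτ, rfl⟩ := hsep
  have hout {n : ℕ} (p : Fin n → ℝ) (E : Fin n → QChannel EA A) :
      assistedCQ N (∑ y, (q y : ℂ) • (σ y ⊗ₖ τ y)) p E =
        cqState p fun x => ∑ y, (q y : ℂ) • (N.map ((E x).map (σ y)) ⊗ₖ τ y) := by
    simp only [assistedCQ, assistedOut_sum_smul_kronecker]
  have hN {n : ℕ} (E : Fin n → QChannel EA A) (x : Fin n) (y : Fin m) :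
      IsState (N.map ((E x).map (σ y))) := N.isState_map ((E x).isState_map (hσ y))
  have hle {n : ℕ} {p : Fin n → ℝ} (hp : IsProbDist p) (E : Fin n → QChannel EA A) :
      mutualInfoS (assistedCQ N (∑ y, (q y : ℂ) • (σ y ⊗ₖ τ y)) p E) ≤
        infoXE_B (assistedCQ N (∑ y, (q y : ℂ) • (σ y ⊗ₖ τ y)) p E) := by
    rw [hout]
    exact mutualInfoS_le_infoXE_B hp
      (fun x => IsState.sum_smul hq fun y => (hN E x y).kronecker (hτ y))
      fun x => ptrL_sum_smul_kronecker q _ τ fun y => (hN E x y).2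
  have hupper {n : ℕ} {p : Fin n → ℝ} (hp : IsProbDist p) (E : Fin n → QChannel EA A) :
      ∃ r ∈ { r | ∃ (n : ℕ) (p : Fin n → ℝ) (σ : Fin n → Matrix A A ℂ),
        IsProbDist p ∧ (∀ x, IsState (σ x)) ∧
        r = mutualInfoS (cqState p fun x => N.map (σ x)) },
      infoXE_B (assistedCQ N (∑ y, (q y : ℂ) • (σ y ⊗ₖ τ y)) p E) ≤ r := by
    refine ⟨_, ⟨n * m, _, fun k => (E (finProdFinEquiv.symm k).1).map
      (σ (finProdFinEquiv.symm k).2), hp.prod hq, fun k => (E _).isState_map (hσ _), rfl⟩, ?_⟩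
    rw [hout]
    exact infoXE_B_le_mutualInfoS hp hq (hN E) hτ
  have hlower {n : ℕ} {p : Fin n → ℝ} (hp : IsProbDist p) {υ : Fin n → Matrix A A ℂ}
      (hυ : ∀ x, IsState (υ x)) :
      mutualInfoS (cqState p fun x => N.map (υ x)) =
        mutualInfoS (assistedCQ N (∑ y, (q y : ℂ) • (σ y ⊗ₖ τ y)) p
          fun x => QChannel.replacer EA (hυ x)) := by
    have h (x : Fin n) : ∑ y, (q y : ℂ) • (N.map (υ x) ⊗ₖ τ y) =
        N.map (υ x) ⊗ₖ ∑ y, (q y : ℂ) • τ y := by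
      ext i j
      simp only [Matrix.sum_apply, Matrix.smul_apply, kroneckerMap_apply, smul_eq_mul,
        Finset.mul_sum, mul_left_comm]
    rw [hout]
    simp only [fun x y => QChannel.replacer_map (hυ x) (hσ y).2, h]
    exact (mutualInfoS_cqState_kronecker hp (fun x => N.isState_map (hυ x))
      (IsState.sum_smul hq hτ)).symm
  constructor
  · refine csSup_eq_csSup_of_forall_exists_le ?_ ?_
    · rintro _ ⟨n, p, E, hp, rfl⟩
      obtain ⟨r, hr, h⟩ := hupper hp E
      exact ⟨r, hr, (hle hp E).trans h⟩
    · rintro _ ⟨n, p, υ, hp, hυ, rfl⟩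
      exact ⟨_, ⟨n, p, _, hp, rfl⟩, (hlower hp hυ).le⟩
  · refine csSup_eq_csSup_of_forall_exists_le ?_ ?_
    · rintro _ ⟨n, p, E, hp, rfl⟩
      exact hupper hp E
    · rintro _ ⟨n, p, υ, hp, hυ, rfl⟩
      exact ⟨_, ⟨n, p, _, hp, rfl⟩, (hlower hp hυ).le.trans (hle hp _)⟩

end QIT
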